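/- For any infinite digraph D, the map λ ↦ f_λ is a bijection between the set of limit edges of D and the set of edge-directions of D. -/

import Mathlib

variable {V : Type*}

/-- Reachability from `a` to `b` by a directed walk staying inside the vertex set `S`. -/
def ReachIn (D : V → V → Prop) (S : Set V) (a b : V) : Prop :=
  a ∈ S ∧ b ∈ S ∧ Relation.ReflTransGen (fun x y => y ∈ S ∧ D x y) a b

/-- `C` is a strong component of the subdigraph of `D` induced on `S`. -/
def IsSCCIn (D : V → V → Prop) (S : Set V) (C : Set V) : Prop :=
  ∃ a ∈ S, C = {b | ReachIn D S a b ∧ ReachIn D S b a}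

/-- A directed ray in `D`. -/
def IsRay (D : V → V → Prop) (R : ℕ → V) : Prop :=
  Function.Injective R ∧ ∀ n, D (R n) (R (n + 1))

/-- A reverse directed ray in `D`. -/
def IsRevRay (D : V → V → Prop) (R : ℕ → V) : Prop :=
  Function.Injective R ∧ ∀ n, D (R (n + 1)) (R n)

/-- The ray `R` has a tail inside the vertex set `C`. -/
def HasTailIn (R : ℕ → V) (C : Set V) : Prop :=
  ∃ n, ∀ m, n ≤ m → R m ∈ C

/-- A solid ray: for every finite `X` it has a tail in some strong component of `D − X`. -/
def Solid (D : V → V → Prop) (R : ℕ → V) : Prop :=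
  IsRay D R ∧ ∀ X : Finset V, ∃ C, IsSCCIn D ((↑X : Set V)ᶜ) C ∧ HasTailIn R C

/-- Two solid rays are end-equivalent: for every finite `X` they have tails in the same
strong component of `D − X`. -/
def EndEquiv (D : V → V → Prop) (R R' : ℕ → V) : Prop :=
  ∀ X : Finset V, ∃ C, IsSCCIn D ((↑X : Set V)ᶜ) C ∧ HasTailIn R C ∧ HasTailIn R' C

/-- `Ω` is an end of `D`: the class of solid rays equivalent to some solid ray. -/
def IsEnd (D : V → V → Prop) (Ω : Set (ℕ → V)) : Prop :=
  ∃ R, Solid D R ∧ Ω = {R' | Solid D R' ∧ EndEquiv D R R'}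

/-- A (nonempty) directed path, recorded as its list of vertices. -/
def IsPathList (D : V → V → Prop) (l : List V) : Prop :=
  l ≠ [] ∧ l.Nodup ∧ l.Chain' D

/-- Infinitely many pairwise disjoint `A`–`B` paths in `D` (each meeting `A` precisely in its
first vertex and `B` precisely in its last vertex). -/
def DisjointPathsFrom (D : V → V → Prop) (A B : Set V) : Prop :=
  ∃ P : ℕ → List V,
    (∀ k, IsPathList D (P k)) ∧
    (∀ j k, j ≠ k → ∀ x ∈ P j, x ∉ P k) ∧
    (∀ k, ∃ a, (P k).head? = some a ∧ a ∈ A) ∧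
    (∀ k, ∃ b, (P k).getLast? = some b ∧ b ∈ B) ∧
    (∀ k, ∀ x ∈ (P k).tail, x ∉ A) ∧
    (∀ k, ∀ x ∈ (P k).dropLast, x ∉ B)

/-- A necklace in `D`: an inflated symmetric ray with finite branch sets (beads), given by its
beads together with the connecting (subdividing) paths in both directions. -/
structure Necklace (D : V → V → Prop) where
  bead : ℕ → Set V
  fwd : ℕ → List V
  bwd : ℕ → List V
  bead_fin : ∀ n, (bead n).Finite
  bead_nonempty : ∀ n, (bead n).Nonempty
  bead_disj : ∀ m n, m ≠ n → Disjoint (bead m) (bead n)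
  bead_strong : ∀ n, ∀ a ∈ bead n, ∀ b ∈ bead n, ReachIn D (bead n) a b
  fwd_path : ∀ n, IsPathList D (fwd n)
  bwd_path : ∀ n, IsPathList D (bwd n)
  fwd_head : ∀ n a, (fwd n).head? = some a → a ∈ bead n
  fwd_last : ∀ n b, (fwd n).getLast? = some b → b ∈ bead (n + 1)
  bwd_head : ∀ n a, (bwd n).head? = some a → a ∈ bead (n + 1)
  bwd_last : ∀ n b, (bwd n).getLast? = some b → b ∈ bead n
  fwd_inner : ∀ n, ∀ x ∈ (fwd n).tail.dropLast, ∀ m, x ∉ bead m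
  bwd_inner : ∀ n, ∀ x ∈ (bwd n).tail.dropLast, ∀ m, x ∉ bead m
  fwd_fwd_disj : ∀ m n, m ≠ n → ∀ x ∈ (fwd m).tail.dropLast, x ∉ (fwd n).tail.dropLast
  bwd_bwd_disj : ∀ m n, m ≠ n → ∀ x ∈ (bwd m).tail.dropLast, x ∉ (bwd n).tail.dropLast
  fwd_bwd_disj : ∀ m n, ∀ x ∈ (fwd m).tail.dropLast, x ∉ (bwd n).tail.dropLast

/-- The vertex set of a necklace. -/
def Necklace.verts {D : V → V → Prop} (N : Necklace D) : Set V :=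
  (⋃ n, N.bead n) ∪ {x | ∃ n, x ∈ N.fwd n ∨ x ∈ N.bwd n}

/-- A necklace is attached to `𝒰` if infinitely many of its beads meet every set in `𝒰`. -/
def Necklace.AttachedTo {D : V → V → Prop} (N : Necklace D) (𝒰 : Finset (Set V)) : Prop :=
  {n | ∀ U ∈ 𝒰, (N.bead n ∩ U).Nonempty}.Infinite

/-- A necklace represents the end of the solid ray `R`: for every finite `X`, all but finitely
many beads lie in the strong component of `D − X` in which `R` has a tail. -/
def NecklaceRepresents {D : V → V → Prop} (N : Necklace D) (R : ℕ → V) : Prop :=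
  ∀ X : Finset V, ∃ C, IsSCCIn D ((↑X : Set V)ᶜ) C ∧ HasTailIn R C ∧
    ∃ n₀, ∀ n, n₀ ≤ n → N.bead n ⊆ C

/-- `URankLE D 𝒰 S α`: the subdigraph of `D` induced on `S` has `𝒰`-rank at most `α`. -/
inductive URankLE (D : V → V → Prop) (𝒰 : Finset (Set V)) : Set V → Ordinal → Prop
  | base (S : Set V) (α : Ordinal) (U : Set V) (hU : U ∈ 𝒰) (h : (U ∩ S).Finite) :
      URankLE D 𝒰 S α
  | step (S : Set V) (α : Ordinal) (X : Finset V) (r : Set V → Ordinal)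
      (hr : ∀ C, IsSCCIn D (S \ ↑X) C → r C < α)
      (h : ∀ C, IsSCCIn D (S \ ↑X) C → URankLE D 𝒰 C (r C)) :
      URankLE D 𝒰 S α

/-- `D` (induced on `S`) has `𝒰`-rank exactly `α`. -/
def HasURank (D : V → V → Prop) (𝒰 : Finset (Set V)) (S : Set V) (α : Ordinal) : Prop :=
  URankLE D 𝒰 S α ∧ ∀ β < α, ¬ URankLE D 𝒰 S β

/-- A vertex-direction of `D`. -/
def IsVertexDirection (D : V → V → Prop) (f : Finset V → Set V) : Prop :=
  (∀ X : Finset V, IsSCCIn D ((↑X : Set V)ᶜ) (f X)) ∧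
  ∀ X Y : Finset V, X ⊆ Y → f Y ⊆ f X

/-- A separation `(A,B)` of `D`: `A ∪ B = V(D)` and no edge from `B∖A` to `A∖B`. -/
def IsSep (D : V → V → Prop) (A B : Set V) : Prop :=
  A ∪ B = Set.univ ∧ ∀ a ∈ B \ A, ∀ b ∈ A \ B, ¬ D a b

/-- A finite order separation `(A,B)` points towards the vertex-direction `f`. -/
def PointsTowards (D : V → V → Prop) (f : Finset V → Set V) (A B : Set V)
    (h : (A ∩ B).Finite) : Prop :=
  f h.toFinset ⊆ B \ A

/-- A finite order separation `(A,B)` points away from the vertex-direction `f`. -/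
def PointsAway (D : V → V → Prop) (f : Finset V → Set V) (A B : Set V)
    (h : (A ∩ B).Finite) : Prop :=
  f h.toFinset ⊆ A \ B

/-- The vertex `v` dominates the vertex-direction `f`. -/
def DomDir (D : V → V → Prop) (v : V) (f : Finset V → Set V) : Prop :=
  ∀ A B, IsSep D A B → ∀ h : (A ∩ B).Finite, PointsAway D f A B h → v ∈ A

/-- An infinite `v`–`B` fan: infinitely many `v`–`B` paths meeting pairwise precisely in `v`. -/
def Fan (D : V → V → Prop) (v : V) (B : Set V) : Prop :=
  ∃ P : ℕ → List V,
    (∀ k, IsPathList D (P k)) ∧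
    (∀ k, (P k).head? = some v) ∧
    (∀ k, 2 ≤ (P k).length) ∧
    (∀ k, ∃ b, (P k).getLast? = some b ∧ b ∈ B) ∧
    (∀ k, ∀ x ∈ (P k).dropLast, x ∉ B) ∧
    (∀ j k, j ≠ k → ∀ x ∈ (P j).tail, x ∉ (P k).tail)

/-- Limit edge between the ends of the solid rays `R` and `R'`. -/
def LimitEdgeEE (D : V → V → Prop) (R R' : ℕ → V) : Prop :=
  ∀ (X : Finset V) C C', IsSCCIn D ((↑X : Set V)ᶜ) C → HasTailIn R C →
    IsSCCIn D ((↑X : Set V)ᶜ) C' → HasTailIn R' C' → C ≠ C' →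
    ∃ a ∈ C, ∃ b ∈ C', D a b

/-- Limit edge from the vertex `v` to the end of the solid ray `R`. -/
def LimitEdgeVE (D : V → V → Prop) (v : V) (R : ℕ → V) : Prop :=
  ∀ (X : Finset V) C, IsSCCIn D ((↑X : Set V)ᶜ) C → HasTailIn R C → v ∉ C →
    ∃ b ∈ C, D v b

/-- Limit edge from the end of the solid ray `R` to the vertex `v`. -/
def LimitEdgeEV (D : V → V → Prop) (R : ℕ → V) (v : V) : Prop :=
  ∀ (X : Finset V) C, IsSCCIn D ((↑X : Set V)ᶜ) C → HasTailIn R C → v ∉ C →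
    ∃ a ∈ C, D a v

/-- A subdivided infinite out-star in `D` with centre `c`, given by its paths. -/
def IsStar (D : V → V → Prop) (c : V) (P : ℕ → List V) : Prop :=
  (∀ k, IsPathList D (P k)) ∧ (∀ k, (P k).head? = some c) ∧
  (∀ k, 2 ≤ (P k).length) ∧
  (∀ j k, j ≠ k → ∀ x ∈ (P j).tail, x ∉ (P k).tail)

/-- A directed comb in `D` with spine `R`, given by its (pairwise disjoint) paths each meeting
`R` precisely in its first vertex. -/
def IsComb (D : V → V → Prop) (R : ℕ → V) (P : ℕ → List V) : Prop :=
  IsRay D R ∧ (∀ k, IsPathList D (P k)) ∧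
  (∀ k, ∃ n, (P k).head? = some (R n)) ∧
  (∀ k, ∀ x ∈ (P k).tail, ∀ n, x ≠ R n) ∧
  (∀ j k, j ≠ k → ∀ x ∈ P j, x ∉ P k)

/-- A star in `D` whose `k`-th leaf is `a k`. -/
def StarAttachedWith (D : V → V → Prop) (a : ℕ → V) : Prop :=
  ∃ c P, IsStar D c P ∧ ∀ k, (P k).getLast? = some (a k)

/-- A comb in `D` whose `k`-th tooth is `a k`. -/
def CombAttachedWith (D : V → V → Prop) (a : ℕ → V) : Prop :=
  ∃ R P, IsComb D R P ∧ ∀ k, (P k).getLast? = some (a k)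

/-- `a` and `b` are consecutive entries of the list `l`. -/
def AdjInList (l : List V) (a b : V) : Prop :=
  ∃ l₁ l₂, l = l₁ ++ a :: b :: l₂

/-- The edge relation of (a subdigraph of `D` forming) the necklace `N`: all `D`-edges inside a
bead together with the edges of the connecting paths. -/
def Necklace.edges {D : V → V → Prop} (N : Necklace D) (a b : V) : Prop :=
  D a b ∧ ((∃ n, a ∈ N.bead n ∧ b ∈ N.bead n) ∨
    (∃ n, AdjInList (N.fwd n) a b ∨ AdjInList (N.bwd n) a b))

/-- A generalized ray: a directed ray (`true`) or a reverse directed ray (`false`). -/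
def IsGenRay (D : V → V → Prop) : Bool × (ℕ → V) → Prop
  | (true, R) => IsRay D R
  | (false, R) => IsRevRay D R

/-- Pre-end equivalence of generalized rays: infinitely many disjoint paths in both
directions. -/
def PreEquiv (D : V → V → Prop) (Q Q' : Bool × (ℕ → V)) : Prop :=
  DisjointPathsFrom D (Set.range Q.2) (Set.range Q'.2) ∧
  DisjointPathsFrom D (Set.range Q'.2) (Set.range Q.2)

/-- The pre-end `γ` includes the end represented by the solid ray `R`. -/
def IncludesEnd (D : V → V → Prop) (γ : Set (Bool × (ℕ → V))) (R : ℕ → V) : Prop :=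
  Solid D R ∧ ∀ R', Solid D R' → EndEquiv D R R' → (true, R') ∈ γ

/-- The set of edges of `D` from `A` to `B`. -/
def EdgesBetween (D : V → V → Prop) (A B : Set V) : Set (V × V) :=
  {e | D e.1 e.2 ∧ e.1 ∈ A ∧ e.2 ∈ B}

/-- A bundle of `D − X`. -/
def IsBundle (D : V → V → Prop) (X : Finset V) (E : Set (V × V)) : Prop :=
  E.Nonempty ∧
  ((∃ C C', IsSCCIn D ((↑X : Set V)ᶜ) C ∧ IsSCCIn D ((↑X : Set V)ᶜ) C' ∧ C ≠ C' ∧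
      E = EdgesBetween D C C') ∨
   (∃ v ∈ X, ∃ C, IsSCCIn D ((↑X : Set V)ᶜ) C ∧
      (E = EdgesBetween D {v} C ∨ E = EdgesBetween D C {v})))

/-- Compatibility `f(X) ⊇ f(Y)` between values of a direction (a strong component is regarded
as containing a bundle if it contains all its edges). -/
def DirCompat : Set V ⊕ Set (V × V) → Set V ⊕ Set (V × V) → Prop
  | Sum.inl C, Sum.inl C' => C' ⊆ C
  | Sum.inl C, Sum.inr E' => ∀ e ∈ E', e.1 ∈ C ∧ e.2 ∈ C
  | Sum.inr _, Sum.inl _ => False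
  | Sum.inr E, Sum.inr E' => E' ⊆ E

/-- A direction of `D`: maps each finite `X` to a strong component or a bundle of `D − X`,
compatibly. -/
def IsDirection (D : V → V → Prop) (f : Finset V → Set V ⊕ Set (V × V)) : Prop :=
  (∀ X : Finset V, (∃ C, IsSCCIn D ((↑X : Set V)ᶜ) C ∧ f X = Sum.inl C) ∨
    (∃ E, IsBundle D X E ∧ f X = Sum.inr E)) ∧
  ∀ X Y : Finset V, X ⊆ Y → DirCompat (f X) (f Y)

/-- An edge-direction: a direction whose value is a bundle for some finite `X`. -/
def IsEdgeDirection (D : V → V → Prop) (f : Finset V → Set V ⊕ Set (V × V)) : Prop :=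
  IsDirection D f ∧ ∃ (X : Finset V) (E : Set (V × V)), f X = Sum.inr E

/-- The three kinds of (potential) limit edges: end–end, vertex–end, end–vertex.
Ends are given as sets of (solid) rays. -/
inductive LimitEdgeObj (V : Type*) where
  | ee (Ω₁ Ω₂ : Set (ℕ → V))
  | ve (v : V) (Ω : Set (ℕ → V))
  | ev (Ω : Set (ℕ → V)) (v : V)

/-- `l` is a limit edge of `D`. -/
def IsLimitEdge (D : V → V → Prop) : LimitEdgeObj V → Prop
  | LimitEdgeObj.ee Ω₁ Ω₂ => IsEnd D Ω₁ ∧ IsEnd D Ω₂ ∧ Ω₁ ≠ Ω₂ ∧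
      ∀ R ∈ Ω₁, ∀ R' ∈ Ω₂, LimitEdgeEE D R R'
  | LimitEdgeObj.ve v Ω => IsEnd D Ω ∧ ∀ R ∈ Ω, LimitEdgeVE D v R
  | LimitEdgeObj.ev Ω v => IsEnd D Ω ∧ ∀ R ∈ Ω, LimitEdgeEV D R v

/-- `f` agrees with the map `f_λ` for the end–end limit edge `Ω₁Ω₂`. -/
def AgreesEE (D : V → V → Prop) (Ω₁ Ω₂ : Set (ℕ → V))
    (f : Finset V → Set V ⊕ Set (V × V)) : Prop :=
  ∀ (X : Finset V), ∀ R ∈ Ω₁, ∀ R' ∈ Ω₂, ∀ C C',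
    IsSCCIn D ((↑X : Set V)ᶜ) C → HasTailIn R C →
    IsSCCIn D ((↑X : Set V)ᶜ) C' → HasTailIn R' C' →
    (C = C' → f X = Sum.inl C) ∧ (C ≠ C' → f X = Sum.inr (EdgesBetween D C C'))

/-- `f` agrees with the map `f_λ` for the vertex–end limit edge `vΩ`. -/
def AgreesVE (D : V → V → Prop) (v : V) (Ω : Set (ℕ → V))
    (f : Finset V → Set V ⊕ Set (V × V)) : Prop :=
  ∀ (X : Finset V), ∀ R ∈ Ω, ∀ C, IsSCCIn D ((↑X : Set V)ᶜ) C → HasTailIn R C →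
    (v ∈ C → f X = Sum.inl C) ∧
    (v ∈ (↑X : Set V) → f X = Sum.inr (EdgesBetween D {v} C)) ∧
    (∀ C', IsSCCIn D ((↑X : Set V)ᶜ) C' → v ∈ C' → C' ≠ C →
      f X = Sum.inr (EdgesBetween D C' C))

/-- `f` agrees with the map `f_λ` for the end–vertex limit edge `Ωv`. -/
def AgreesEV (D : V → V → Prop) (Ω : Set (ℕ → V)) (v : V)
    (f : Finset V → Set V ⊕ Set (V × V)) : Prop :=
  ∀ (X : Finset V), ∀ R ∈ Ω, ∀ C, IsSCCIn D ((↑X : Set V)ᶜ) C → HasTailIn R C →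
    (v ∈ C → f X = Sum.inl C) ∧
    (v ∈ (↑X : Set V) → f X = Sum.inr (EdgesBetween D C {v})) ∧
    (∀ C', IsSCCIn D ((↑X : Set V)ᶜ) C' → v ∈ C' → C' ≠ C →
      f X = Sum.inr (EdgesBetween D C C'))

/-- `f` agrees with `f_λ` for the limit edge `l`. -/
def Agrees (D : V → V → Prop) : LimitEdgeObj V → (Finset V → Set V ⊕ Set (V × V)) → Prop
  | LimitEdgeObj.ee Ω₁ Ω₂, f => AgreesEE D Ω₁ Ω₂ f
  | LimitEdgeObj.ve v Ω, f => AgreesVE D v Ω f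
  | LimitEdgeObj.ev Ω v, f => AgreesEV D Ω v f

section Helpers

theorem ReachIn.refl' {D : V → V → Prop} {S : Set V} {a : V} (h : a ∈ S) : ReachIn D S a a :=
  ⟨h, h, Relation.ReflTransGen.refl⟩

theorem ReachIn.trans' {D : V → V → Prop} {S : Set V} {a b c : V} (h : ReachIn D S a b)
    (h' : ReachIn D S b c) : ReachIn D S a c :=
  ⟨h.1, h'.2.1, h.2.2.trans h'.2.2⟩

theorem ReachIn.mono' {D : V → V → Prop} {S T : Set V} (hST : S ⊆ T) {a b : V}
    (h : ReachIn D S a b) : ReachIn D T a b :=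
  ⟨hST h.1, hST h.2.1, Relation.ReflTransGen.mono (fun _ _ h => ⟨hST h.1, h.2⟩) _ _ h.2.2⟩

theorem ReachIn.head' {D : V → V → Prop} {S : Set V} {a b c : V} (ha : a ∈ S) (h : D a b)
    (h' : ReachIn D S b c) : ReachIn D S a c :=
  ⟨ha, h'.2.1, Relation.ReflTransGen.head ⟨h'.1, h⟩ h'.2.2⟩

theorem scc_nonempty {D : V → V → Prop} {S C : Set V} (h : IsSCCIn D S C) : C.Nonempty := by
  obtain ⟨a, ha, rfl⟩ := h
  exact ⟨a, ReachIn.refl' ha, ReachIn.refl' ha⟩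

theorem scc_subset {D : V → V → Prop} {S C : Set V} (h : IsSCCIn D S C) : C ⊆ S := by
  obtain ⟨a, ha, rfl⟩ := h
  intro x hx
  exact hx.1.2.1

theorem scc_reach {D : V → V → Prop} {S C : Set V} (h : IsSCCIn D S C) {a b : V} (ha : a ∈ C)
    (hb : b ∈ C) : ReachIn D S a b := by
  obtain ⟨c, hc, rfl⟩ := h
  exact ha.2.trans' hb.1

theorem scc_convex {D : V → V → Prop} {S C : Set V} (h : IsSCCIn D S C) {a b c : V} (ha : a ∈ C)
    (hc : c ∈ C) (hab : ReachIn D S a b) (hbc : ReachIn D S b c) : b ∈ C := by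
  obtain ⟨d, hd, rfl⟩ := h
  exact ⟨ha.1.trans' hab, hbc.trans' hc.2⟩

theorem scc_of_mem {D : V → V → Prop} {S : Set V} {a : V} (ha : a ∈ S) :
    ∃ C, IsSCCIn D S C ∧ a ∈ C :=
  ⟨_, ⟨a, ha, rfl⟩, ReachIn.refl' ha, ReachIn.refl' ha⟩

/-- Strongly connected vertex set. -/
def SC (D : V → V → Prop) (H : Set V) : Prop := ∀ a ∈ H, ∀ b ∈ H, ReachIn D H a b

theorem scc_SC {D : V → V → Prop} {S C : Set V} (h : IsSCCIn D S C) : SC D C := by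
  intro a ha b hb
  obtain ⟨-, hbS, hr⟩ := scc_reach h ha hb
  induction hr using Relation.ReflTransGen.head_induction_on with
  | refl => exact ReachIn.refl' hb
  | head hac hcb ih =>
    have hc := scc_convex h ha hb
      ⟨scc_subset h ha, hac.1, Relation.ReflTransGen.single hac⟩ ⟨hac.1, hbS, hcb⟩
    exact ReachIn.head' ha hac.2 (ih hc)

theorem SC_sub_scc {D : V → V → Prop} {S C H : Set V} (h : IsSCCIn D S C) (hH : SC D H)
    (hHS : H ⊆ S) {a : V} (ha : a ∈ H) (haC : a ∈ C) : H ⊆ C := fun b hb =>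
  scc_convex h haC haC ((hH a ha b hb).mono' hHS) ((hH b hb a ha).mono' hHS)

theorem scc_eq {D : V → V → Prop} {S C C' : Set V} (h : IsSCCIn D S C) (h' : IsSCCIn D S C')
    {a : V} (ha : a ∈ C) (ha' : a ∈ C') : C = C' :=
  Set.Subset.antisymm (SC_sub_scc h' (scc_SC h) (scc_subset h) ha ha')
    (SC_sub_scc h (scc_SC h') (scc_subset h') ha' ha)

theorem reach_finite {D : V → V → Prop} {S : Set V} {a b : V} (h : ReachIn D S a b) :
    ∃ P : Set V, P.Finite ∧ P ⊆ S ∧ a ∈ P ∧ b ∈ P ∧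
      ∀ x ∈ P, ReachIn D P a x ∧ ReachIn D P x b := by
  obtain ⟨ha, hb, hr⟩ := h
  induction hr using Relation.ReflTransGen.head_induction_on with
  | refl =>
    refine ⟨{b}, Set.finite_singleton b, by simpa using hb, rfl, rfl, ?_⟩
    rintro x rfl
    exact ⟨ReachIn.refl' rfl, ReachIn.refl' rfl⟩
  | @head a c hac hcb ih =>
    obtain ⟨P, hP, hPS, hcP, hbP, hx⟩ := ih hac.1
    have hs : P ⊆ insert a P := Set.subset_insert a P
    have hai : a ∈ insert a P := Set.mem_insert a P
    refine ⟨insert a P, hP.insert a, Set.insert_subset ha hPS, hai, hs hbP, ?_⟩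
    rintro x (rfl | hxP)
    · exact ⟨ReachIn.refl' hai, ReachIn.head' hai hac.2 ((hx b hbP).1.mono' hs)⟩
    · exact ⟨ReachIn.head' hai hac.2 ((hx x hxP).1.mono' hs), (hx x hxP).2.mono' hs⟩

theorem finite_SC_hull {D : V → V → Prop} {C T : Set V} (hC : SC D C) (hT : T.Finite)
    (hTC : T ⊆ C) : ∃ H : Set V, H.Finite ∧ T ⊆ H ∧ H ⊆ C ∧ SC D H := by
  rcases T.eq_empty_or_nonempty with rfl | ⟨t, ht⟩
  · exact ⟨∅, Set.finite_empty, le_rfl, hTC, fun a ha => ha.elim⟩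
  have key : ∀ a : T, ∃ P : Set V, P.Finite ∧ P ⊆ C ∧ a.1 ∈ P ∧
      ∀ x ∈ P, ReachIn D P t x ∧ ReachIn D P x t := by
    rintro ⟨a, ha⟩
    obtain ⟨P, hP, hPC, h1, h2, h3⟩ := reach_finite (hC t (hTC ht) a (hTC ha))
    obtain ⟨Q, hQ, hQC, k1, k2, k3⟩ := reach_finite (hC a (hTC ha) t (hTC ht))
    have hp : P ⊆ P ∪ Q := Set.subset_union_left
    have hq : Q ⊆ P ∪ Q := Set.subset_union_right
    refine ⟨P ∪ Q, hP.union hQ, Set.union_subset hPC hQC, Or.inl h2, ?_⟩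
    have e1 : ReachIn D (P ∪ Q) t a := (h3 a h2).1.mono' hp
    have e2 : ReachIn D (P ∪ Q) a t := (k3 a k1).2.mono' hq
    rintro x (hx | hx)
    · exact ⟨(h3 x hx).1.mono' hp, ((h3 x hx).2.mono' hp).trans' e2⟩
    · exact ⟨e1.trans' ((k3 x hx).1.mono' hq), (k3 x hx).2.mono' hq⟩
  choose P hP hPC haP hx using key
  have : Finite T := hT
  refine ⟨⋃ a, P a, Set.finite_iUnion hP, ?_, Set.iUnion_subset hPC, ?_⟩
  · intro a ha
    exact Set.mem_iUnion.2 ⟨⟨a, ha⟩, haP ⟨a, ha⟩⟩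
  · intro a ha b hb
    obtain ⟨i, hi⟩ := Set.mem_iUnion.1 ha
    obtain ⟨j, hj⟩ := Set.mem_iUnion.1 hb
    exact ((hx i a hi).2.mono' (Set.subset_iUnion P i)).trans'
      ((hx j b hj).1.mono' (Set.subset_iUnion P j))

/-! Walks and rays -/

theorem reach_walk {D : V → V → Prop} {S : Set V} {a b : V} (h : ReachIn D S a b) (hab : a ≠ b) :
    ∃ (k : ℕ) (p : ℕ → V), 0 < k ∧ p 0 = a ∧ p k = b ∧ (∀ i, i < k → D (p i) (p (i + 1))) ∧
      ∀ i, i ≤ k → p i ∈ S := by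
  have : ∃ (k : ℕ) (p : ℕ → V), p 0 = a ∧ p k = b ∧ (∀ i, i < k → D (p i) (p (i + 1))) ∧
      ∀ i, i ≤ k → p i ∈ S := by
    obtain ⟨ha, hb, hr⟩ := h
    clear hab
    induction hr using Relation.ReflTransGen.head_induction_on with
    | refl => exact ⟨0, fun _ => b, rfl, rfl, fun i hi => absurd hi (by omega), fun _ _ => hb⟩
    | @head a c hac hcb ih =>
      obtain ⟨k, p, h0, hk, hD, hS⟩ := ih hac.1
      refine ⟨k + 1, fun i => Nat.casesOn i a p, rfl, hk, ?_, ?_⟩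
      · rintro (_ | i) hi
        · simpa [h0] using hac.2
        · exact hD i (by omega)
      · rintro (_ | i) hi
        · exact ha
        · exact hS i (by omega)
  obtain ⟨k, p, h0, hk, hD, hS⟩ := this
  refine ⟨k, p, ?_, h0, hk, hD, hS⟩
  rcases Nat.eq_zero_or_pos k with rfl | h
  · exact absurd (h0.symm.trans hk) hab
  · exact h

theorem concat_walk {D : V → V → Prop} (S : ℕ → Set V) (y : ℕ → V)
    (hy : ∀ n, y n ≠ y (n + 1)) (hr : ∀ n, ReachIn D (S n) (y n) (y (n + 1))) :
    ∃ w : ℕ → V, (∀ n, D (w n) (w (n + 1))) ∧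
      ∀ N, ∃ M, ∀ m, M ≤ m → ∃ n, N ≤ n ∧ w m ∈ S n := by
  choose k p hk h0 hkk hD hS using fun n => reach_walk (hr n) (hy n)
  let nxt : ℕ × ℕ → ℕ × ℕ := fun q => if q.2 + 1 < k q.1 then (q.1, q.2 + 1) else (q.1 + 1, 0)
  let s : ℕ → ℕ × ℕ := fun m => Nat.rec (0, 0) (fun _ q => nxt q) m
  have hs : ∀ m, s (m + 1) = nxt (s m) := fun m => rfl
  have hlt : ∀ m, (s m).2 < k (s m).1 := by
    intro m
    induction m with
    | zero => exact hk 0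
    | succ m ih =>
      rw [hs]
      by_cases h : (s m).2 + 1 < k (s m).1
      · simp only [nxt, if_pos h]; exact h
      · simp only [nxt, if_neg h]; exact hk _
  have hmono : Monotone fun m => (s m).1 := by
    apply monotone_nat_of_le_succ
    intro m
    simp only [hs, nxt]
    split_ifs <;> simp
  have hreach : ∀ N, ∃ m, s m = (N, 0) := by
    intro N
    induction N with
    | zero => exact ⟨0, rfl⟩
    | succ N ih =>
      obtain ⟨m, hm⟩ := ih
      have : ∀ i, i < k N → s (m + i) = (N, i) := by
        intro i
        induction i with
        | zero => intro _; exact hm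
        | succ i ih' =>
          intro hi
          rw [← add_assoc, hs, ih' (by omega)]
          simp [nxt, hi]
      refine ⟨m + (k N - 1) + 1, ?_⟩
      have hkN := hk N
      rw [hs, this _ (by omega)]
      simp only [nxt]
      rw [if_neg (by omega)]
  refine ⟨fun m => p (s m).1 (s m).2, ?_, ?_⟩
  · intro m
    have := hD _ _ (hlt m)
    change D (p (s m).1 (s m).2) (p (s (m + 1)).1 (s (m + 1)).2)
    rw [hs]
    by_cases h : (s m).2 + 1 < k (s m).1
    · simpa only [nxt, if_pos h] using this
    · have e : (s m).2 + 1 = k (s m).1 := by have := hlt m; omega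
      simp only [nxt, if_neg h]
      rw [e, hkk] at this
      rwa [h0]
  · intro N
    obtain ⟨M, hM⟩ := hreach N
    refine ⟨M, fun m hm => ⟨(s m).1, ?_, hS _ _ (hlt m).le⟩⟩
    have := hmono hm
    simpa [hM] using this

theorem ray_of_walk {D : V → V → Prop} (w : ℕ → V) (hw : ∀ n, D (w n) (w (n + 1)))
    (hfin : ∀ v, ∃ M, ∀ m, M ≤ m → w m ≠ v) :
    ∃ t : ℕ → ℕ, StrictMono t ∧ IsRay D (w ∘ t) := by
  have hlast : ∀ n, ∃ l, n ≤ l ∧ w l = w n ∧ ∀ m, l < m → w m ≠ w n := by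
    intro n
    classical
    obtain ⟨M, hM⟩ := hfin (w n)
    have hnM : n ≤ M := by
      by_contra h
      exact hM n (by omega) rfl
    refine ⟨Nat.findGreatest (fun m => w m = w n) M, Nat.le_findGreatest hnM rfl,
      Nat.findGreatest_spec (P := fun m => w m = w n) hnM rfl, ?_⟩
    intro m hm he
    rcases le_total M m with h | h
    · exact hM m h he
    · exact absurd (Nat.le_findGreatest (P := fun m => w m = w n) h he) (by omega)
  choose l hl hwl hlm using hlast
  let t : ℕ → ℕ := fun n => Nat.rec (l 0) (fun _ q => l (q + 1)) n
  have ht : ∀ n, t (n + 1) = l (t n + 1) := fun n => rfl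
  have htm : StrictMono t := strictMono_nat_of_lt_succ fun n => by
    rw [ht]; exact lt_of_lt_of_le (Nat.lt_succ_self _) (hl _)
  have htl : ∀ n m, t n < m → w m ≠ w (t n) := by
    rintro (_ | n) m hm
    · have := hlm 0 m hm
      rwa [← hwl 0] at this
    · have := hlm (t n + 1) m hm
      rwa [← hwl (t n + 1)] at this
  refine ⟨t, htm, ?_, ?_⟩
  · intro a b hab
    by_contra hne
    rcases lt_or_gt_of_ne hne with h | h
    · exact htl a _ (htm h) hab.symm
    · exact htl b _ (htm h) hab
  · intro n
    simp only [Function.comp]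
    rw [ht, hwl]
    exact hw _

/-! Vertex-directions -/

theorem vd_sub {D : V → V → Prop} {f : Finset V → Set V} (hf : IsVertexDirection D f)
    {A B : Finset V} (h : ∀ x ∈ f A, x ∉ B) : f A ⊆ f B := by
  classical
  obtain ⟨a, ha⟩ := scc_nonempty (hf.1 (A ∪ B))
  exact SC_sub_scc (hf.1 B) (scc_SC (hf.1 A)) (fun x hx => by simpa using h x hx)
    (hf.2 A (A ∪ B) Finset.subset_union_left ha)
    (hf.2 B (A ∪ B) Finset.subset_union_right ha)

theorem vd_not_mem {D : V → V → Prop} {f : Finset V → Set V} (hf : IsVertexDirection D f)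
    {A : Finset V} {x : V} (hx : x ∈ f A) : x ∉ A := by
  simpa using scc_subset (hf.1 A) hx

theorem vd_ray_of_seq {D : V → V → Prop} {f : Finset V → Set V} (hf : IsVertexDirection D f)
    (S : ℕ → Set V) (y : ℕ → V)
    (hy : ∀ n, y n ≠ y (n + 1)) (hr : ∀ n, ReachIn D (S n) (y n) (y (n + 1)))
    (hS : ∀ X, ∃ N, ∀ n, N ≤ n → S n ⊆ f X) :
    ∃ R, Solid D R ∧ ∀ X, HasTailIn R (f X) := by
  obtain ⟨w, hw, hwS⟩ := concat_walk S y hy hr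
  have hwX : ∀ X, ∃ M, ∀ m, M ≤ m → w m ∈ f X := by
    intro X
    obtain ⟨N, hN⟩ := hS X
    obtain ⟨M, hM⟩ := hwS N
    refine ⟨M, fun m hm => ?_⟩
    obtain ⟨n, hn, hmem⟩ := hM m hm
    exact hN n hn hmem
  obtain ⟨t, ht, hray⟩ := ray_of_walk w hw (fun v => by
    obtain ⟨M, hM⟩ := hwX {v}
    refine ⟨M, fun m hm he => ?_⟩
    exact vd_not_mem hf (hM m hm) (by simp [he]))
  have htail : ∀ X, HasTailIn (w ∘ t) (f X) := by
    intro X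
    obtain ⟨M, hM⟩ := hwX X
    exact ⟨M, fun m hm => hM _ (hm.trans (ht.id_le m))⟩
  exact ⟨w ∘ t, ⟨hray, fun X => ⟨f X, hf.1 X, htail X⟩⟩, htail⟩

/-- Good set: finite, strongly connected, and never separated from `f`. -/
def Good (D : V → V → Prop) (f : Finset V → Set V) (H : Finset V) : Prop :=
  H.Nonempty ∧ SC D (H : Set V) ∧ ∀ X : Finset V, Disjoint X H → (H : Set V) ⊆ f X

theorem vd_caseA {D : V → V → Prop} {f : Finset V → Set V} (hf : IsVertexDirection D f)
    (h : ∀ Z : Finset V, ∃ H, Good D f H ∧ Disjoint Z H) :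
    ∃ R, Solid D R ∧ ∀ X, HasTailIn R (f X) := by
  classical
  -- state: used set, current good set, chosen vertex
  let St := {q : Finset V × Finset V × V // Good D f q.2.1 ∧ Disjoint q.1 q.2.1 ∧ q.2.2 ∈ q.2.1}
  have step : ∀ q : St, ∃ (q' : St) (P : Finset V), ReachIn D (P : Set V) q.1.2.2 q'.1.2.2 ∧
      q.1.2.2 ≠ q'.1.2.2 ∧ q.1.1 ⊆ q'.1.1 ∧ q.1.2.1 ⊆ q'.1.1 ∧ P ⊆ q'.1.1 ∪ q'.1.2.1 ∧
      Disjoint q.1.1 P ∧ ∀ x ∈ P, ReachIn D (P : Set V) q.1.2.2 x ∧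
        ReachIn D (P : Set V) x q'.1.2.2 := by
    rintro ⟨⟨Z, H, y⟩, hG, hZH, hyH⟩
    obtain ⟨H', hG', hd⟩ := h (Z ∪ H)
    obtain ⟨y', hy'⟩ := hG'.1
    rw [Finset.disjoint_union_left] at hd
    have hyf : y ∈ f Z := hG.2.2 Z hZH hyH
    have hyf' : y' ∈ f Z := hG'.2.2 Z hd.1 hy'
    obtain ⟨P, hP, hPf, h1, h2, h3⟩ := reach_finite (scc_SC (hf.1 Z) y hyf y' hyf')
    lift P to Finset V using hP
    refine ⟨⟨⟨Z ∪ H ∪ (P \ H'), H', y'⟩, hG', ?_, hy'⟩, P, (h3 y' h2).1, ?_, ?_, ?_, ?_, ?_, h3⟩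
    · rw [Finset.disjoint_union_left, Finset.disjoint_union_left]
      exact ⟨hd, Finset.sdiff_disjoint⟩
    · rintro rfl
      exact Finset.disjoint_left.1 hd.2 hyH hy'
    · intro x hx; simp_all
    · intro x hx; simp_all
    · intro x hx
      by_cases hxH : x ∈ H' <;> simp_all
    · rw [Finset.disjoint_left]
      intro x hx hxP
      exact vd_not_mem hf (hPf hxP) hx
  choose nx P h1 h2 h3 h4 h5 h6 h7 using step
  obtain ⟨H0, hG0, hd0⟩ := h ∅
  obtain ⟨y0, hy0⟩ := hG0.1
  let q0 : St := ⟨⟨∅, H0, y0⟩, hG0, hd0, hy0⟩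
  let s : ℕ → St := fun n => Nat.rec q0 (fun _ q => nx q) n
  have hs : ∀ n, s (n + 1) = nx (s n) := fun n => rfl
  have hZmono : Monotone fun n => (s n).1.1 := monotone_nat_of_le_succ fun n => by
    rw [hs]; exact h3 _
  have hPZ : ∀ n, P (s n) ⊆ (s (n + 2)).1.1 := by
    intro n
    refine (h5 (s n)).trans (Finset.union_subset ?_ ?_)
    · rw [← hs]; exact hZmono (Nat.le_succ (n + 1))
    · rw [← hs]; exact h4 _
  have hdisj : ∀ n m, n + 2 ≤ m → Disjoint (P (s n)) (P (s m)) := by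
    intro n m hnm
    exact Finset.disjoint_of_subset_left ((hPZ n).trans (hZmono hnm)) (h6 (s m))
  have hev1 : ∀ v, ∃ N, ∀ n, N ≤ n → v ∉ P (s n) := by
    intro v
    by_cases hv : ∃ n, v ∈ P (s n)
    · obtain ⟨n, hn⟩ := hv
      exact ⟨n + 2, fun m hm => Finset.disjoint_left.1 (hdisj n m hm) hn⟩
    · exact ⟨0, fun n _ hn => hv ⟨n, hn⟩⟩
  have hevZ : ∀ v, ∃ N, ∀ n, N ≤ n → v ∉ (s n).1.2.1 := by
    intro v
    by_cases hv : ∃ n, v ∈ (s n).1.2.1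
    · obtain ⟨n, hn⟩ := hv
      refine ⟨n + 1, fun m hm => Finset.disjoint_left.1 (s m).2.2.1 (hZmono hm ?_)⟩
      have := h4 (s n) hn
      rwa [← hs] at this
    · exact ⟨0, fun n _ hn => hv ⟨n, hn⟩⟩
  choose N1 hN1 using hev1
  choose N2 hN2 using hevZ
  refine vd_ray_of_seq hf (fun n => (P (s n) : Set V)) (fun n => (s n).1.2.2)
    (fun n => h2 _) (fun n => h1 _) ?_
  intro X
  refine ⟨X.sup N1 + X.sup N2, fun n hn => ?_⟩
  have hXP : ∀ m, n ≤ m → Disjoint X (s m).1.2.1 := fun m hm => Finset.disjoint_left.2 fun x hx =>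
    hN2 x m (by have := Finset.le_sup (f := N2) hx; omega)
  have hPX : (P (s n) : Set V) ⊆ ((X : Set V))ᶜ := fun x hx hxX =>
    hN1 x n (by have := Finset.le_sup (f := N1) hxX; omega) hx
  have a1 : (s n).1.2.2 ∈ f X := (s n).2.1.2.2 X (hXP n le_rfl) (s n).2.2.2
  have a2 : (s (n + 1)).1.2.2 ∈ f X :=
    (s (n + 1)).2.1.2.2 X (hXP _ (Nat.le_succ n)) (s (n + 1)).2.2.2
  intro x hx
  exact scc_convex (hf.1 X) a1 a2 ((h7 (s n) x hx).1.mono' hPX) ((h7 (s n) x hx).2.mono' hPX)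

theorem vd_caseB {D : V → V → Prop} {f : Finset V → Set V} (hf : IsVertexDirection D f)
    (U : Finset V) (h : ∀ H, Good D f H → ¬ Disjoint U H) :
    ∃ R, Solid D R ∧ ∀ X, HasTailIn R (f X) := by
  classical
  let St := {Y : Finset V // Y.Nonempty ∧ SC D (Y : Set V) ∧ (Y : Set V) ⊆ f U}
  have sep : ∀ Y : St, ∃ X : Finset V, U ⊆ X ∧ Disjoint X Y.1 ∧ ∀ x ∈ f X, x ∉ Y.1 := by
    rintro ⟨Y, hne, hSC, hYU⟩
    have hUY : Disjoint U Y := Finset.disjoint_left.2 fun x hx hxY => vd_not_mem hf (hYU hxY) hx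
    have : ¬ Good D f Y := fun hG => h Y hG hUY
    have : ∃ X : Finset V, Disjoint X Y ∧ ¬ (Y : Set V) ⊆ f X := by
      by_contra hcon
      push Not at hcon
      exact this ⟨hne, hSC, hcon⟩
    obtain ⟨X, hXY, hX⟩ := this
    have hd : Disjoint (U ∪ X) Y := Finset.disjoint_union_left.2 ⟨hUY, hXY⟩
    refine ⟨U ∪ X, Finset.subset_union_left, hd, fun x hx hxY => hX ?_⟩
    refine (SC_sub_scc (hf.1 (U ∪ X)) hSC ?_ hxY hx).trans (hf.2 _ _ Finset.subset_union_right)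
    intro z hz hzX
    exact Finset.disjoint_left.1 hd hzX hz
  choose X hUX hXY hfX using sep
  have grow : ∀ Y : St, ∃ Y' : St, Y.1 ⊆ Y'.1 ∧ ∀ x ∈ X Y, x ∈ f U → x ∈ Y'.1 := by
    intro Y
    obtain ⟨H, hH, hTH, hHC, hHS⟩ := finite_SC_hull (scc_SC (hf.1 U))
      (T := (Y.1 : Set V) ∪ {x | x ∈ X Y ∧ x ∈ f U})
      (Y.1.finite_toSet.union ((X Y).finite_toSet.subset fun x hx => hx.1))
      (Set.union_subset Y.2.2.2 fun x hx => hx.2)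
    lift H to Finset V using hH
    have hY : Y.1 ⊆ H := fun x hx => hTH (Or.inl hx)
    exact ⟨⟨H, Y.2.1.mono hY, hHS, hHC⟩, hY, fun x hx hxU => hTH (Or.inr ⟨hx, hxU⟩)⟩
  choose nx hnx1 hnx2 using grow
  obtain ⟨y0, hy0⟩ := scc_nonempty (hf.1 U)
  let Y0 : St := ⟨{y0}, by simp, by
    intro a ha b hb
    obtain rfl : a = y0 := by simpa using ha
    obtain rfl : b = a := by simpa using hb
    exact ReachIn.refl' ha, by simpa using hy0⟩
  let s : ℕ → St := fun n => Nat.rec Y0 (fun _ q => nx q) n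
  have hs : ∀ n, s (n + 1) = nx (s n) := fun n => rfl
  have hYmono : Monotone fun n => (s n).1 := monotone_nat_of_le_succ fun n => by
    rw [hs]; exact hnx1 _
  have hXU : ∀ n, f (X (s n)) ⊆ f U := fun n => hf.2 _ _ (hUX _)
  have hdec : Antitone fun n => f (X (s n)) := antitone_nat_of_succ_le fun n => by
    refine vd_sub hf fun x hx hxX => hfX _ x hx ?_
    rw [hs]
    exact hnx2 _ x hxX (hXU (n + 1) hx)
  have hXd : ∀ n m, n < m → ∀ x ∈ f U, x ∈ X (s n) → x ∉ X (s m) := by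
    intro n m hnm x hxU hx hxm
    have : x ∈ (s (n + 1)).1 := by rw [hs]; exact hnx2 _ x hx hxU
    exact Finset.disjoint_left.1 (hXY (s m)) hxm (hYmono hnm this)
  have hev : ∀ v ∈ f U, ∃ N, ∀ n, N ≤ n → v ∉ X (s n) := by
    intro v hv
    by_cases hv' : ∃ n, v ∈ X (s n)
    · obtain ⟨n, hn⟩ := hv'
      exact ⟨n + 1, fun m hm => hXd n m hm v hv hn⟩
    · exact ⟨0, fun n _ hn => hv' ⟨n, hn⟩⟩
  have hout : ∀ v, ∃ N, ∀ n, N ≤ n → v ∉ f (X (s n)) := by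
    intro v
    by_cases hv : v ∈ f U
    · obtain ⟨W, hW, hTW, hWC, hWS⟩ := finite_SC_hull (scc_SC (hf.1 U)) (T := {v, y0})
        (by simp) (by rintro x (rfl | rfl) <;> assumption)
      lift W to Finset V using hW
      choose! N hN using hev
      refine ⟨W.sup N, fun n hn hvn => ?_⟩
      have hWX : (W : Set V) ⊆ ((X (s n) : Finset V) : Set V)ᶜ := fun x hx hxX =>
        hN x (hWC hx) n ((Finset.le_sup (f := N) hx).trans hn) hxX
      have := SC_sub_scc (hf.1 (X (s n))) hWS hWX (hTW (Or.inl rfl)) hvn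
      refine hfX (s n) y0 (this (hTW (Or.inr rfl))) (hYmono (Nat.zero_le n) ?_)
      change y0 ∈ Y0.1
      simp [Y0]
    · exact ⟨0, fun n _ hn => hv (hXU n hn)⟩
  have hex : ∀ n (v : V), ∃ z ∈ f (X (s n)), v ≠ z := by
    intro n v
    obtain ⟨z, hz⟩ := scc_nonempty (hf.1 (insert v (X (s n))))
    refine ⟨z, hf.2 _ _ (Finset.subset_insert _ _) hz, ?_⟩
    rintro rfl
    exact vd_not_mem hf hz (Finset.mem_insert_self _ _)
  choose g hg hgne using hex
  let y : ℕ → V := fun n => Nat.rec (g 0 y0) (fun n v => g (n + 1) v) n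
  have hy : ∀ n, y n ∈ f (X (s n)) := by
    rintro (_ | n)
    · exact hg 0 y0
    · exact hg (n + 1) (y n)
  refine vd_ray_of_seq hf (fun n => f (X (s n))) y (fun n => hgne (n + 1) (y n)) (fun n => ?_) ?_
  · exact scc_SC (hf.1 _) _ (hy n) _ (hdec (Nat.le_succ n) (hy (n + 1)))
  · intro Z
    choose N hN using hout
    refine ⟨Z.sup N, fun n hn => vd_sub hf fun x hx hxZ => ?_⟩
    exact hN x n ((Finset.le_sup (f := N) hxZ).trans hn) hx

theorem vd_ray {D : V → V → Prop} {f : Finset V → Set V} (hf : IsVertexDirection D f) :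
    ∃ R, Solid D R ∧ ∀ X, HasTailIn R (f X) := by
  by_cases h : ∀ Z : Finset V, ∃ H, Good D f H ∧ Disjoint Z H
  · exact vd_caseA hf h
  · push Not at h
    obtain ⟨U, hU⟩ := h
    exact vd_caseB hf U hU

/-! Atoms and points -/

/-- Atom of `X`: strong component of `D - X` or a singleton inside `X`. -/
def IsAtomAt (D : V → V → Prop) (X : Finset V) (A : Set V) : Prop :=
  IsSCCIn D ((↑X : Set V)ᶜ) A ∨ ∃ v ∈ X, A = {v}

theorem IsAtomAt.nonempty {D : V → V → Prop} {X : Finset V} {A : Set V} (h : IsAtomAt D X A) :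
    A.Nonempty := by
  rcases h with h | ⟨v, -, rfl⟩
  · exact scc_nonempty h
  · exact ⟨v, rfl⟩

theorem IsAtomAt.sub {D : V → V → Prop} {X Y : Finset V} {A B : Set V} (hXY : X ⊆ Y)
    (hA : IsAtomAt D X A) (hB : IsAtomAt D Y B) {a : V} (ha : a ∈ A) (hb : a ∈ B) : B ⊆ A := by
  rcases hB with hB | ⟨w, hw, rfl⟩
  · rcases hA with hA | ⟨v, hv, rfl⟩
    · refine SC_sub_scc hA (scc_SC hB) ((scc_subset hB).trans ?_) hb ha
      intro x hx hxX
      exact hx (hXY hxX)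
    · obtain rfl : a = v := ha
      exact absurd (hXY hv) (scc_subset hB hb)
  · obtain rfl : a = w := hb
    simpa using ha

theorem IsAtomAt.eq {D : V → V → Prop} {X : Finset V} {A B : Set V}
    (hA : IsAtomAt D X A) (hB : IsAtomAt D X B) {a : V} (ha : a ∈ A) (hb : a ∈ B) : A = B :=
  Set.Subset.antisymm (hB.sub le_rfl hA hb ha) (hA.sub le_rfl hB ha hb)

theorem exists_atom (D : V → V → Prop) (X : Finset V) (a : V) : ∃ A, IsAtomAt D X A ∧ a ∈ A := by
  by_cases h : a ∈ X
  · exact ⟨{a}, Or.inr ⟨a, h, rfl⟩, rfl⟩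
  · obtain ⟨C, hC, ha⟩ := scc_of_mem (D := D) (S := (↑X : Set V)ᶜ) (a := a) (by simpa using h)
    exact ⟨C, Or.inl hC, ha⟩

theorem bundle_iff {D : V → V → Prop} {X : Finset V} {E : Set (V × V)} :
    IsBundle D X E ↔ E.Nonempty ∧ ∃ A B, IsAtomAt D X A ∧ IsAtomAt D X B ∧ A ≠ B ∧
      (IsSCCIn D ((↑X : Set V)ᶜ) A ∨ IsSCCIn D ((↑X : Set V)ᶜ) B) ∧ E = EdgesBetween D A B := by
  have hne : ∀ v ∈ X, ∀ C, IsSCCIn D ((↑X : Set V)ᶜ) C → {v} ≠ C := by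
    rintro v hv C hC rfl
    exact scc_subset hC rfl hv
  constructor
  · rintro ⟨hE, ⟨C, C', hC, hC', hn, rfl⟩ | ⟨v, hv, C, hC, rfl | rfl⟩⟩
    · exact ⟨hE, C, C', Or.inl hC, Or.inl hC', hn, Or.inl hC, rfl⟩
    · exact ⟨hE, {v}, C, Or.inr ⟨v, hv, rfl⟩, Or.inl hC, hne v hv C hC, Or.inr hC, rfl⟩
    · exact ⟨hE, C, {v}, Or.inl hC, Or.inr ⟨v, hv, rfl⟩, (hne v hv C hC).symm, Or.inl hC, rfl⟩
  · rintro ⟨hE, A, B, hA, hB, hn, hor, rfl⟩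
    refine ⟨hE, ?_⟩
    rcases hA with hA | ⟨v, hv, rfl⟩
    · rcases hB with hB | ⟨w, hw, rfl⟩
      · exact Or.inl ⟨A, B, hA, hB, hn, rfl⟩
      · exact Or.inr ⟨w, hw, A, hA, Or.inr rfl⟩
    · rcases hor with h | h
      · exact absurd rfl (hne v hv _ h)
      · exact Or.inr ⟨v, hv, B, h, Or.inl rfl⟩

/-- A consistent choice of atoms. -/
def IsPoint (D : V → V → Prop) (s : Finset V → Set V) : Prop :=
  (∀ X, IsAtomAt D X (s X)) ∧ ∀ X Y : Finset V, X ⊆ Y → s Y ⊆ s X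

/-- The map of the pair of points `s`, `t`. -/
noncomputable def fl (D : V → V → Prop) (s t : Finset V → Set V) (X : Finset V) :
    Set V ⊕ Set (V × V) :=
  letI := Classical.propDecidable (s X = t X)
  if s X = t X then Sum.inl (s X) else Sum.inr (EdgesBetween D (s X) (t X))

theorem fl_eq {D : V → V → Prop} {s t : Finset V → Set V} {X : Finset V} (h : s X = t X) :
    fl D s t X = Sum.inl (s X) := by simp [fl, h]

theorem fl_ne {D : V → V → Prop} {s t : Finset V → Set V} {X : Finset V} (h : s X ≠ t X) :
    fl D s t X = Sum.inr (EdgesBetween D (s X) (t X)) := by simp [fl, h]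

/-- Pairs of points that give edge-directions. -/
structure Pair (D : V → V → Prop) (s t : Finset V → Set V) : Prop where
  hs : IsPoint D s
  ht : IsPoint D t
  ne : s ≠ t
  edge : ∀ X, s X ≠ t X → (EdgesBetween D (s X) (t X)).Nonempty
  scc : ∀ X : Finset V, IsSCCIn D ((↑X : Set V)ᶜ) (s X) ∨ IsSCCIn D ((↑X : Set V)ᶜ) (t X)

theorem edges_mono {D : V → V → Prop} {A B A' B' : Set V} (hA : A ⊆ A') (hB : B ⊆ B') :
    EdgesBetween D A B ⊆ EdgesBetween D A' B' := fun _ he => ⟨he.1, hA he.2.1, hB he.2.2⟩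

theorem Pair.edgeDir {D : V → V → Prop} {s t : Finset V → Set V} (h : Pair D s t) :
    IsEdgeDirection D (fl D s t) := by
  refine ⟨⟨fun X => ?_, fun X Y hXY => ?_⟩, ?_⟩
  · by_cases he : s X = t X
    · refine Or.inl ⟨s X, ?_, fl_eq he⟩
      rcases h.scc X with h | h
      · exact h
      · rwa [he]
    · exact Or.inr ⟨_, bundle_iff.2 ⟨h.edge X he, s X, t X, h.hs.1 X, h.ht.1 X, he, h.scc X, rfl⟩,
        fl_ne he⟩
  · have hs := h.hs.2 X Y hXY
    have ht := h.ht.2 X Y hXY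
    by_cases hX : s X = t X
    · rw [fl_eq hX]
      by_cases hY : s Y = t Y
      · rw [fl_eq hY]; exact hs
      · rw [fl_ne hY]
        intro e he
        exact ⟨hs he.2.1, hX ▸ ht he.2.2⟩
    · rw [fl_ne hX]
      by_cases hY : s Y = t Y
      · exfalso
        obtain ⟨a, ha⟩ := (h.hs.1 Y).nonempty
        exact hX ((h.hs.1 X).eq (h.ht.1 X) (hs ha) (ht (hY ▸ ha)))
      · rw [fl_ne hY]
        exact edges_mono hs ht
  · by_contra hcon
    push Not at hcon
    apply h.ne
    funext X
    by_contra he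
    exact hcon X _ (fl_ne he)

theorem Pair.inj {D : V → V → Prop} {s t s' t' : Finset V → Set V} (h : Pair D s t)
    (h' : Pair D s' t') (he : fl D s t = fl D s' t') : s = s' ∧ t = t' := by
  classical
  obtain ⟨X0, hX0⟩ := Function.ne_iff.1 h.ne
  have key : ∀ X, s X = s' X ∧ t X = t' X := by
    intro X
    have hsub : X ⊆ X ∪ X0 := Finset.subset_union_left
    have hsub0 : X0 ⊆ X ∪ X0 := Finset.subset_union_right
    generalize X ∪ X0 = Y at hsub hsub0
    have hY : s Y ≠ t Y := by
      intro hY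
      obtain ⟨a, ha⟩ := (h.hs.1 Y).nonempty
      exact hX0 ((h.hs.1 X0).eq (h.ht.1 X0) (h.hs.2 _ _ hsub0 ha) (h.ht.2 _ _ hsub0 (hY ▸ ha)))
    have e := congrFun he Y
    rw [fl_ne hY] at e
    have hY' : s' Y ≠ t' Y := by
      intro hY'
      rw [fl_eq hY'] at e
      cases e
    rw [fl_ne hY'] at e
    obtain ⟨p, hp⟩ := h.edge Y hY
    have hp' : p ∈ EdgesBetween D (s' Y) (t' Y) := (Sum.inr.inj e) ▸ hp
    exact ⟨(h.hs.1 X).eq (h'.hs.1 X) (h.hs.2 _ _ hsub hp.2.1) (h'.hs.2 _ _ hsub hp'.2.1),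
      (h.ht.1 X).eq (h'.ht.1 X) (h.ht.2 _ _ hsub hp.2.2) (h'.ht.2 _ _ hsub hp'.2.2)⟩
  exact ⟨funext fun X => (key X).1, funext fun X => (key X).2⟩

theorem edgeDir_pair {D : V → V → Prop} {f : Finset V → Set V ⊕ Set (V × V)}
    (hf : IsEdgeDirection D f) : ∃ s t, Pair D s t ∧ f = fl D s t := by
  classical
  obtain ⟨⟨h1, h2⟩, X0, E0, hX0⟩ := hf
  have hb : ∀ X, ∃ E, IsBundle D (X ∪ X0) E ∧ f (X ∪ X0) = Sum.inr E := by
    intro X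
    rcases h1 (X ∪ X0) with ⟨C, hC, he⟩ | h
    · have := h2 X0 (X ∪ X0) Finset.subset_union_right
      rw [hX0, he] at this
      exact this.elim
    · exact h
  choose E hE hfE using hb
  have hmonoE : ∀ X Y, X ⊆ Y → E Y ⊆ E X := by
    intro X Y hXY
    have := h2 (X ∪ X0) (Y ∪ X0) (Finset.union_subset_union_left hXY)
    rw [hfE, hfE] at this
    exact this
  have hE' := fun X => bundle_iff.1 (hE X)
  choose hne A B hA hB hAB hscc hEE using hE'
  choose p hp using hne
  have hpA : ∀ X, (p X).1 ∈ A X := fun X => by have := hp X; rw [hEE] at this; exact this.2.1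
  have hpB : ∀ X, (p X).2 ∈ B X := fun X => by have := hp X; rw [hEE] at this; exact this.2.2
  choose s hs hps using fun X => exists_atom D X (p X).1
  choose t ht hpt using fun X => exists_atom D X (p X).2
  have hAs : ∀ X, A X ⊆ s X := fun X =>
    (hs X).sub Finset.subset_union_left (hA X) (hps X) (hpA X)
  have hBt : ∀ X, B X ⊆ t X := fun X =>
    (ht X).sub Finset.subset_union_left (hB X) (hpt X) (hpB X)
  have hpm : ∀ X Y, X ⊆ Y → (p Y).1 ∈ A X ∧ (p Y).2 ∈ B X := by
    intro X Y hXY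
    have := hmonoE X Y hXY (hp Y)
    rw [hEE] at this
    exact this.2
  have hsP : IsPoint D s := ⟨hs, fun X Y hXY =>
    (hs X).sub hXY (hs Y) (hAs X (hpm X Y hXY).1) (hps Y)⟩
  have htP : IsPoint D t := ⟨ht, fun X Y hXY =>
    (ht X).sub hXY (ht Y) (hBt X (hpm X Y hXY).2) (hpt Y)⟩
  have hfeq : ∀ X, f X = fl D s t X ∧ (s X ≠ t X → (EdgesBetween D (s X) (t X)).Nonempty) ∧
      ((∃ F, f X = Sum.inr F) → s X ≠ t X) ∧
      (IsSCCIn D ((↑X : Set V)ᶜ) (s X) ∨ IsSCCIn D ((↑X : Set V)ᶜ) (t X)) := by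
    intro X
    have hc := h2 X (X ∪ X0) Finset.subset_union_left
    rw [hfE] at hc
    rcases h1 X with ⟨C, hC, he⟩ | ⟨F, hF, he⟩
    · rw [he] at hc
      have hc' := hc _ (hp X)
      have e1 : s X = C := (hs X).eq (Or.inl hC) (hps X) hc'.1
      have e2 : t X = C := (ht X).eq (Or.inl hC) (hpt X) hc'.2
      refine ⟨by rw [he, fl_eq (e1.trans e2.symm), e1], fun h => absurd (e1.trans e2.symm) h,
        ?_, Or.inl (e1 ▸ hC)⟩
      rintro ⟨G, hG⟩
      rw [he] at hG
      cases hG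
    · rw [he] at hc
      obtain ⟨hFne, A', B', hA', hB', hn, hor, rfl⟩ := bundle_iff.1 hF
      have hc' : p X ∈ EdgesBetween D A' B' := hc (hp X)
      have e1 : s X = A' := (hs X).eq hA' (hps X) hc'.2.1
      have e2 : t X = B' := (ht X).eq hB' (hpt X) hc'.2.2
      subst e1 e2
      exact ⟨by rw [he, fl_ne hn], fun _ => hFne, fun _ => hn, hor⟩
  refine ⟨s, t, ⟨hsP, htP, ?_, fun X => (hfeq X).2.1, fun X => (hfeq X).2.2.2⟩,
    funext fun X => (hfeq X).1⟩
  intro hst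
  exact (hfeq X0).2.2.1 ⟨E0, hX0⟩ (congrFun hst X0)

/-! Points from vertices and ends -/

/-- The point given by a vertex. -/
def vPt (D : V → V → Prop) (v : V) (X : Finset V) : Set V :=
  {b | b = v ∨ (ReachIn D ((↑X : Set V)ᶜ) v b ∧ ReachIn D ((↑X : Set V)ᶜ) b v)}

theorem mem_vPt (D : V → V → Prop) (v : V) (X : Finset V) : v ∈ vPt D v X := Or.inl rfl

theorem vPt_mem {D : V → V → Prop} {v : V} {X : Finset V} (h : v ∈ X) : vPt D v X = {v} := by
  ext b
  constructor
  · rintro (h' | h')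
    · exact h'
    · exact absurd h h'.1.1
  · exact fun h => Or.inl h

theorem vPt_atom (D : V → V → Prop) (v : V) (X : Finset V) : IsAtomAt D X (vPt D v X) := by
  by_cases h : v ∈ X
  · exact Or.inr ⟨v, h, vPt_mem h⟩
  · have hv : v ∈ ((↑X : Set V)ᶜ) := by simpa using h
    refine Or.inl ⟨v, hv, ?_⟩
    ext b
    constructor
    · rintro (rfl | h')
      · exact ⟨ReachIn.refl' hv, ReachIn.refl' hv⟩
      · exact h'
    · exact fun h => Or.inr h

theorem vPt_point (D : V → V → Prop) (v : V) : IsPoint D (vPt D v) :=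
  ⟨vPt_atom D v, fun X Y hXY => (vPt_atom D v X).sub hXY (vPt_atom D v Y)
    (mem_vPt D v X) (mem_vPt D v Y)⟩

theorem vPt_inj {D : V → V → Prop} {v w : V} (h : vPt D v = vPt D w) : v = w := by
  have h1 := mem_vPt D w {v}
  rw [← h, vPt_mem (by simp)] at h1
  exact h1.symm

theorem vPt_not_vd {D : V → V → Prop} {v : V} (h : IsVertexDirection D (vPt D v)) : False :=
  vd_not_mem h (mem_vPt D v {v}) (by simp)

theorem vd_point {D : V → V → Prop} {s : Finset V → Set V} (h : IsVertexDirection D s) :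
    IsPoint D s := ⟨fun X => Or.inl (h.1 X), h.2⟩

theorem point_cases {D : V → V → Prop} {s : Finset V → Set V} (h : IsPoint D s) :
    (∃ v, s = vPt D v) ∨ IsVertexDirection D s := by
  classical
  by_cases hs : ∀ X : Finset V, IsSCCIn D ((↑X : Set V)ᶜ) (s X)
  · exact Or.inr ⟨hs, h.2⟩
  · left
    push Not at hs
    obtain ⟨X, hX⟩ := hs
    obtain ⟨v, hv, he⟩ := (h.1 X).resolve_left hX
    refine ⟨v, funext fun Y => ?_⟩
    obtain ⟨a, ha⟩ := (h.1 (X ∪ Y)).nonempty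
    have h1 := h.2 _ _ Finset.subset_union_left ha
    have h2 := h.2 _ _ Finset.subset_union_right ha
    rw [he] at h1
    obtain rfl : a = v := h1
    exact (h.1 Y).eq (vPt_atom D a Y) h2 (mem_vPt D a Y)

theorem tail_meet {R : ℕ → V} {C C' : Set V} (h : HasTailIn R C) (h' : HasTailIn R C') :
    ∃ a, a ∈ C ∧ a ∈ C' := by
  obtain ⟨n, hn⟩ := h
  obtain ⟨m, hm⟩ := h'
  exact ⟨R (max n m), hn _ (le_max_left _ _), hm _ (le_max_right _ _)⟩

/-- The point given by an end. -/
def ePt (D : V → V → Prop) (Ω : Set (ℕ → V)) (X : Finset V) : Set V :=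
  {a | ∃ C, IsSCCIn D ((↑X : Set V)ᶜ) C ∧ a ∈ C ∧ ∃ R ∈ Ω, HasTailIn R C}

theorem ePt_eq {D : V → V → Prop} {Ω : Set (ℕ → V)} (hΩ : IsEnd D Ω) {X : Finset V} {R : ℕ → V}
    (hR : R ∈ Ω) {C : Set V} (hC : IsSCCIn D ((↑X : Set V)ᶜ) C) (hRC : HasTailIn R C) :
    ePt D Ω X = C := by
  ext a
  constructor
  · rintro ⟨C', hC', ha, R', hR', hRC'⟩
    obtain ⟨R0, hR0, rfl⟩ := hΩ
    obtain ⟨C1, hC1, k1, k2⟩ := hR.2 X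
    obtain ⟨C2, hC2, l1, l2⟩ := hR'.2 X
    obtain ⟨x, hx, hx'⟩ := tail_meet hRC k2
    obtain ⟨y, hy, hy'⟩ := tail_meet k1 l1
    obtain ⟨z, hz, hz'⟩ := tail_meet l2 hRC'
    rw [scc_eq hC hC1 hx hx', scc_eq hC1 hC2 hy hy', scc_eq hC2 hC' hz hz']
    exact ha
  · exact fun ha => ⟨C, hC, ha, R, hR, hRC⟩

theorem end_solid {D : V → V → Prop} {Ω : Set (ℕ → V)} (hΩ : IsEnd D Ω) {R : ℕ → V}
    (hR : R ∈ Ω) : Solid D R := by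
  obtain ⟨R0, hR0, rfl⟩ := hΩ
  exact hR.1

theorem end_nonempty {D : V → V → Prop} {Ω : Set (ℕ → V)} (hΩ : IsEnd D Ω) : ∃ R, R ∈ Ω := by
  obtain ⟨R0, hR0, rfl⟩ := hΩ
  refine ⟨R0, hR0, fun X => ?_⟩
  obtain ⟨C, hC, h⟩ := hR0.2 X
  exact ⟨C, hC, h, h⟩

theorem ePt_tail {D : V → V → Prop} {Ω : Set (ℕ → V)} (hΩ : IsEnd D Ω) {R : ℕ → V} (hR : R ∈ Ω)
    (X : Finset V) : IsSCCIn D ((↑X : Set V)ᶜ) (ePt D Ω X) ∧ HasTailIn R (ePt D Ω X) := by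
  obtain ⟨C, hC, h⟩ := (end_solid hΩ hR).2 X
  rw [ePt_eq hΩ hR hC h]
  exact ⟨hC, h⟩

theorem ePt_vd {D : V → V → Prop} {Ω : Set (ℕ → V)} (hΩ : IsEnd D Ω) :
    IsVertexDirection D (ePt D Ω) := by
  obtain ⟨R, hR⟩ := end_nonempty hΩ
  refine ⟨fun X => (ePt_tail hΩ hR X).1, fun X Y hXY => ?_⟩
  obtain ⟨a, ha, ha'⟩ := tail_meet (ePt_tail hΩ hR X).2 (ePt_tail hΩ hR Y).2
  exact IsAtomAt.sub hXY (Or.inl (ePt_tail hΩ hR X).1) (Or.inl (ePt_tail hΩ hR Y).1) ha ha'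

theorem mem_end_iff {D : V → V → Prop} {Ω : Set (ℕ → V)} (hΩ : IsEnd D Ω) {R : ℕ → V} :
    R ∈ Ω ↔ Solid D R ∧ ∀ X, HasTailIn R (ePt D Ω X) := by
  refine ⟨fun h => ⟨end_solid hΩ h, fun X => (ePt_tail hΩ h X).2⟩, fun h => ?_⟩
  have hΩ' := hΩ
  obtain ⟨R0, hR0, rfl⟩ := hΩ'
  have hm : R0 ∈ {R' | Solid D R' ∧ EndEquiv D R0 R'} := by
    refine ⟨hR0, fun X => ?_⟩
    obtain ⟨C, hC, h⟩ := hR0.2 X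
    exact ⟨C, hC, h, h⟩
  exact ⟨h.1, fun X => ⟨_, (ePt_tail hΩ hm X).1, (ePt_tail hΩ hm X).2, h.2 X⟩⟩

theorem ePt_inj {D : V → V → Prop} {Ω Ω' : Set (ℕ → V)} (hΩ : IsEnd D Ω) (hΩ' : IsEnd D Ω')
    (h : ePt D Ω = ePt D Ω') : Ω = Ω' := by
  ext R
  rw [mem_end_iff hΩ, mem_end_iff hΩ', h]

theorem vd_end {D : V → V → Prop} {s : Finset V → Set V} (h : IsVertexDirection D s) :
    ∃ Ω, IsEnd D Ω ∧ ePt D Ω = s := by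
  obtain ⟨R, hR, ht⟩ := vd_ray h
  have hE : IsEnd D {R' | Solid D R' ∧ EndEquiv D R R'} := ⟨R, hR, rfl⟩
  refine ⟨_, hE, funext fun X => ePt_eq hE (R := R) ⟨hR, fun Y => ?_⟩ (h.1 X) (ht X)⟩
  exact ⟨s Y, h.1 Y, ht Y, ht Y⟩

/-! Limit edges as pairs of points -/

/-- Source point of a limit edge. -/
def srcPt (D : V → V → Prop) : LimitEdgeObj V → Finset V → Set V
  | LimitEdgeObj.ee Ω _ => ePt D Ω
  | LimitEdgeObj.ve v _ => vPt D v
  | LimitEdgeObj.ev Ω _ => ePt D Ω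

/-- Target point of a limit edge. -/
def tgtPt (D : V → V → Prop) : LimitEdgeObj V → Finset V → Set V
  | LimitEdgeObj.ee _ Ω => ePt D Ω
  | LimitEdgeObj.ve _ Ω => ePt D Ω
  | LimitEdgeObj.ev _ v => vPt D v

theorem limit_pair {D : V → V → Prop} {l : LimitEdgeObj V} (h : IsLimitEdge D l) :
    Pair D (srcPt D l) (tgtPt D l) := by
  cases l with
  | ee Ω Ω' =>
    obtain ⟨h1, h2, hn, h3⟩ := h
    refine ⟨vd_point (ePt_vd h1), vd_point (ePt_vd h2), fun he => hn (ePt_inj h1 h2 he), ?_,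
      fun X => Or.inl ((ePt_vd h1).1 X)⟩
    intro X hX
    obtain ⟨R, hR⟩ := end_nonempty h1
    obtain ⟨R', hR'⟩ := end_nonempty h2
    have a := ePt_tail h1 hR X
    have b := ePt_tail h2 hR' X
    obtain ⟨x, hx, y, hy, hxy⟩ := h3 R hR R' hR' X _ _ a.1 a.2 b.1 b.2 hX
    exact ⟨(x, y), hxy, hx, hy⟩
  | ve v Ω =>
    obtain ⟨h2, h3⟩ := h
    refine ⟨vPt_point D v, vd_point (ePt_vd h2), fun he => vPt_not_vd (D := D) (v := v) ?_, ?_,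
      fun X => Or.inr ((ePt_vd h2).1 X)⟩
    · change vPt D v = ePt D Ω at he
      rw [he]; exact ePt_vd h2
    intro X hX
    obtain ⟨R', hR'⟩ := end_nonempty h2
    have b := ePt_tail h2 hR' X
    obtain ⟨y, hy, hxy⟩ := h3 R' hR' X _ b.1 b.2
      (fun hv => hX ((vPt_atom D v X).eq (Or.inl b.1) (mem_vPt D v X) hv))
    exact ⟨(v, y), hxy, mem_vPt D v X, hy⟩
  | ev Ω v =>
    obtain ⟨h2, h3⟩ := h
    refine ⟨vd_point (ePt_vd h2), vPt_point D v, fun he => vPt_not_vd (D := D) (v := v) ?_, ?_,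
      fun X => Or.inl ((ePt_vd h2).1 X)⟩
    · change ePt D Ω = vPt D v at he
      rw [← he]; exact ePt_vd h2
    intro X hX
    obtain ⟨R', hR'⟩ := end_nonempty h2
    have b := ePt_tail h2 hR' X
    obtain ⟨y, hy, hxy⟩ := h3 R' hR' X _ b.1 b.2
      (fun hv => hX (IsAtomAt.eq (Or.inl b.1) (vPt_atom D v X) hv (mem_vPt D v X)))
    exact ⟨(y, v), hxy, hy, mem_vPt D v X⟩

theorem limit_inj {D : V → V → Prop} {l l' : LimitEdgeObj V} (h : IsLimitEdge D l)
    (h' : IsLimitEdge D l') (hs : srcPt D l = srcPt D l') (ht : tgtPt D l = tgtPt D l') :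
    l = l' := by
  have no : ∀ {v Ω}, IsEnd D Ω → vPt D v = ePt D Ω → False := fun hΩ he =>
    vPt_not_vd (he ▸ ePt_vd hΩ)
  cases l with
  | ee Ω₁ Ω₂ =>
    cases l' with
    | ee Ω₃ Ω₄ => rw [ePt_inj h.1 h'.1 hs, ePt_inj h.2.1 h'.2.1 ht]
    | ve v Ω => exact (no h.1 hs.symm).elim
    | ev Ω v => exact (no h.2.1 ht.symm).elim
  | ve v Ω =>
    cases l' with
    | ee Ω₃ Ω₄ => exact (no h'.1 hs).elim
    | ve v Ω => rw [vPt_inj hs, ePt_inj h.1 h'.1 ht]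
    | ev Ω v => exact (no h'.1 hs).elim
  | ev Ω v =>
    cases l' with
    | ee Ω₃ Ω₄ => exact (no h'.2.1 ht).elim
    | ve v Ω => exact (no h.1 hs.symm).elim
    | ev Ω v => rw [vPt_inj ht, ePt_inj h.1 h'.1 hs]

theorem limit_agrees {D : V → V → Prop} {l : LimitEdgeObj V} (h : IsLimitEdge D l) :
    Agrees D l (fl D (srcPt D l) (tgtPt D l)) := by
  cases l with
  | ee Ω Ω' =>
    intro X R hR R' hR' C C' hC hRC hC' hRC'
    have e1 := ePt_eq h.1 hR hC hRC
    have e2 := ePt_eq h.2.1 hR' hC' hRC'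
    subst e1 e2
    exact ⟨fun he => fl_eq he, fun he => fl_ne he⟩
  | ve v Ω =>
    intro X R hR C hC hRC
    have e1 := ePt_eq h.1 hR hC hRC
    subst e1
    refine ⟨fun hv => ?_, fun hv => ?_, fun C' hC' hv hn => ?_⟩
    · have he := (vPt_atom D v X).eq (Or.inl hC) (mem_vPt D v X) hv
      exact (fl_eq (s := vPt D v) (t := ePt D Ω) he).trans (by rw [he])
    · have hn : vPt D v X ≠ ePt D Ω X := fun he => scc_subset hC (he ▸ mem_vPt D v X) hv
      exact (fl_ne (s := vPt D v) (t := ePt D Ω) hn).trans (by rw [vPt_mem hv])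
    · have he := (vPt_atom D v X).eq (Or.inl hC') (mem_vPt D v X) hv
      subst he
      exact fl_ne hn
  | ev Ω v =>
    intro X R hR C hC hRC
    have e1 := ePt_eq h.1 hR hC hRC
    subst e1
    refine ⟨fun hv => ?_, fun hv => ?_, fun C' hC' hv hn => ?_⟩
    · have he := (vPt_atom D v X).eq (Or.inl hC) (mem_vPt D v X) hv
      exact fl_eq (s := ePt D Ω) (t := vPt D v) he.symm
    · have hn : ePt D Ω X ≠ vPt D v X := fun he => scc_subset hC (he ▸ mem_vPt D v X) hv
      exact (fl_ne (s := ePt D Ω) (t := vPt D v) hn).trans (by rw [vPt_mem hv])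
    · have he := (vPt_atom D v X).eq (Or.inl hC') (mem_vPt D v X) hv
      subst he
      exact fl_ne hn.symm

theorem pair_limit {D : V → V → Prop} {s t : Finset V → Set V} (h : Pair D s t) :
    ∃ l, IsLimitEdge D l ∧ srcPt D l = s ∧ tgtPt D l = t := by
  classical
  rcases point_cases h.hs with ⟨v, rfl⟩ | hs
  · rcases point_cases h.ht with ⟨w, rfl⟩ | ht
    · exfalso
      rcases h.scc {v, w} with h | h
      · exact scc_subset h (mem_vPt D v _) (by simp)
      · exact scc_subset h (mem_vPt D w _) (by simp)
    · obtain ⟨Ω, hΩ, rfl⟩ := vd_end ht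
      refine ⟨LimitEdgeObj.ve v Ω, ⟨hΩ, ?_⟩, rfl, rfl⟩
      intro R hR X C hC hRC hv
      have e1 := ePt_eq hΩ hR hC hRC
      subst e1
      have hn : vPt D v (insert v X) ≠ ePt D Ω (insert v X) := fun he =>
        vd_not_mem ht (he ▸ mem_vPt D v _) (Finset.mem_insert_self _ _)
      obtain ⟨e, he⟩ := h.edge _ hn
      rw [vPt_mem (Finset.mem_insert_self _ _)] at he
      have e1 : e.1 = v := he.2.1
      exact ⟨e.2, ht.2 _ _ (Finset.subset_insert _ _) he.2.2, e1 ▸ he.1⟩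
  · obtain ⟨Ω, hΩ, rfl⟩ := vd_end hs
    rcases point_cases h.ht with ⟨v, rfl⟩ | ht
    · refine ⟨LimitEdgeObj.ev Ω v, ⟨hΩ, ?_⟩, rfl, rfl⟩
      intro R hR X C hC hRC hv
      have e1 := ePt_eq hΩ hR hC hRC
      subst e1
      have hn : ePt D Ω (insert v X) ≠ vPt D v (insert v X) := fun he =>
        vd_not_mem hs (he ▸ mem_vPt D v _) (Finset.mem_insert_self _ _)
      obtain ⟨e, he⟩ := h.edge _ hn
      rw [vPt_mem (Finset.mem_insert_self _ _)] at he
      have e1 : e.2 = v := he.2.2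
      exact ⟨e.1, hs.2 _ _ (Finset.subset_insert _ _) he.2.1, e1 ▸ he.1⟩
    · obtain ⟨Ω', hΩ', rfl⟩ := vd_end ht
      refine ⟨LimitEdgeObj.ee Ω Ω', ⟨hΩ, hΩ', ?_, ?_⟩, rfl, rfl⟩
      · rintro rfl
        exact h.ne rfl
      intro R hR R' hR' X C C' hC hRC hC' hRC' hne
      have e1 := ePt_eq hΩ hR hC hRC
      have e2 := ePt_eq hΩ' hR' hC' hRC'
      subst e1 e2
      obtain ⟨e, he⟩ := h.edge X hne
      exact ⟨e.1, he.2.1, e.2, he.2.2, he.1⟩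

end Helpers

/-- The map `λ ↦ f_λ` is a bijection between the limit edges and the edge-directions of an
infinite digraph. -/
theorem limit_edges_equiv_edge_directions (D : V → V → Prop) [Infinite V] :
    ∃ F : {l : LimitEdgeObj V // IsLimitEdge D l} →
        {f : Finset V → Set V ⊕ Set (V × V) // IsEdgeDirection D f},
      Function.Bijective F ∧ ∀ l, Agrees D l.1 (F l).1 := by
  refine ⟨fun l => ⟨fl D (srcPt D l.1) (tgtPt D l.1), (limit_pair l.2).edgeDir⟩, ⟨?_, ?_⟩,
    fun l => limit_agrees l.2⟩
  · intro l l' he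
    obtain ⟨h1, h2⟩ := (limit_pair l.2).inj (limit_pair l'.2) (Subtype.ext_iff.1 he)
    exact Subtype.ext (limit_inj l.2 l'.2 h1 h2)
  · rintro ⟨f, hf⟩
    obtain ⟨s, t, hp, rfl⟩ := edgeDir_pair hf
    obtain ⟨l, hl, rfl, rfl⟩ := pair_limit hp
    exact ⟨⟨l, hl⟩, rfl⟩
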